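/- Let T be the centerless topological N=2 superconformal algebra and V = T⊗T with the adjoint diagonal action. Every derivation d ∈ Der(T, V) decomposes as a summable sum d = Σ_{i∈ℤ} d_i of homogeneous derivations d_i ∈ Der(T, V) of degree i (determined by d_i(u) being the V_{i+j}-component of d(u) for u ∈ T_j), and this sum is in fact finite: only finitely many d_i are nonzero. -/

import Mathlib

/-!
Common setup: the centerless topological N=2 superconformal algebra `T`,
modelled as the free ℂ-module on basis `{L_n, H_n, G_n, Q_n : n ∈ ℤ}`
(encoded as finitely supported functions `(N2Gen × ℤ) →₀ ℂ`), together with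
its super-bracket, the tensor square `TT` and cube `TTT` (modelled as
finitely supported functions on pairs/triples of indices), the adjoint
diagonal actions, the super-twist and super-cyclic maps, parity and degree
predicates, (inner) super-derivations, the coboundary map `Δ_r = innerDer r`,
the classical Yang–Baxter expression `c(r)`, and the Lie super-bialgebra
predicate.
-/

noncomputable section

/-- The four families of generators of the topological N=2 superconformal algebra. -/
inductive N2Gen : Type
  | L | H | G | Q
  deriving DecidableEq

/-- Index of a basis vector: a generator family together with an integer degree. -/
abbrev N2Idx : Type := N2Gen × ℤ

/-- ℤ/2-parity of a basis vector: `false` = even (`L`, `H`), `true` = odd (`G`, `Q`). -/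
def N2parity : N2Idx → Bool
  | (N2Gen.L, _) => false
  | (N2Gen.H, _) => false
  | (N2Gen.G, _) => true
  | (N2Gen.Q, _) => true

/-- The underlying vector space of the centerless topological N=2 superconformal
algebra: the free ℂ-module on the basis indexed by `N2Idx`. -/
abbrev TopN2 : Type := N2Idx →₀ ℂ

/-- The basis vector `L_n`, `H_n`, `G_n` or `Q_n`. -/
def bT (g : N2Gen) (n : ℤ) : TopN2 := Finsupp.single (g, n) 1

/-- The basis vector with index `i`. -/
def sing (i : N2Idx) : TopN2 := Finsupp.single i 1

/-- The bracket on basis vectors, given by the structure constants of the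
centerless topological N=2 superconformal algebra:
`[L_m,L_n] = (m−n)L_{m+n}`, `[L_m,H_n] = −n H_{m+n}`, `[L_m,G_n] = (m−n)G_{m+n}`,
`[L_m,Q_n] = −n Q_{m+n}`, `[H_m,G_n] = G_{m+n}`, `[H_m,Q_n] = −Q_{m+n}`,
`[G_m,Q_n] = 2L_{m+n} − 2n H_{m+n}`, extended super-skew-symmetrically,
all other brackets of basis vectors being zero. -/
def bracketAux : N2Idx → N2Idx → TopN2
  | (N2Gen.L, m), (N2Gen.L, n) => (m - n : ℂ) • bT N2Gen.L (m + n)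
  | (N2Gen.L, m), (N2Gen.H, n) => (-n : ℂ) • bT N2Gen.H (m + n)
  | (N2Gen.H, m), (N2Gen.L, n) => (m : ℂ) • bT N2Gen.H (m + n)
  | (N2Gen.L, m), (N2Gen.G, n) => (m - n : ℂ) • bT N2Gen.G (m + n)
  | (N2Gen.G, m), (N2Gen.L, n) => (m - n : ℂ) • bT N2Gen.G (m + n)
  | (N2Gen.L, m), (N2Gen.Q, n) => (-n : ℂ) • bT N2Gen.Q (m + n)
  | (N2Gen.Q, m), (N2Gen.L, n) => (m : ℂ) • bT N2Gen.Q (m + n)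
  | (N2Gen.H, m), (N2Gen.G, n) => bT N2Gen.G (m + n)
  | (N2Gen.G, m), (N2Gen.H, n) => -(bT N2Gen.G (m + n))
  | (N2Gen.H, m), (N2Gen.Q, n) => -(bT N2Gen.Q (m + n))
  | (N2Gen.Q, m), (N2Gen.H, n) => bT N2Gen.Q (m + n)
  | (N2Gen.G, m), (N2Gen.Q, n) =>
      (2 : ℂ) • bT N2Gen.L (m + n) + (-2 * n : ℂ) • bT N2Gen.H (m + n)
  | (N2Gen.Q, m), (N2Gen.G, n) =>
      (2 : ℂ) • bT N2Gen.L (m + n) + (-2 * m : ℂ) • bT N2Gen.H (m + n)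
  | _, _ => 0

/-- The super-bracket of `T`, extended bilinearly from the basis. -/
def brk (x y : TopN2) : TopN2 :=
  x.sum fun i a => y.sum fun j b => (a * b) • bracketAux i j

/-- The sign `(−1)^b` for a parity `b : Bool` (`false ↦ 1`, `true ↦ −1`). -/
def psgn (b : Bool) : ℂ := if b then -1 else 1

/-- The Koszul sign `(−1)^{[i][j]}` for two basis indices. -/
def ksgn (i j : N2Idx) : ℂ := psgn (N2parity i && N2parity j)

/-- `x` is ℤ/2-homogeneous of parity `q` (i.e. `x ∈ T^q`). -/
def IsParityT (q : Bool) (x : TopN2) : Prop := ∀ i ∈ x.support, N2parity i = q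

/-- `x` is ℤ-homogeneous of degree `n` (i.e. `x ∈ T_n = span{L_n,H_n,G_n,Q_n}`). -/
def IsDegT (n : ℤ) (x : TopN2) : Prop := ∀ i ∈ x.support, i.2 = n

/-- The tensor square `T ⊗ T`, modelled as the free ℂ-module on pairs of indices. -/
abbrev TT : Type := (N2Idx × N2Idx) →₀ ℂ

/-- Parity of a basis vector `e_{q.1} ⊗ e_{q.2}` of `T ⊗ T`. -/
def pparity (q : N2Idx × N2Idx) : Bool := xor (N2parity q.1) (N2parity q.2)

/-- `v ∈ T ⊗ T` is ℤ/2-homogeneous of parity `p`. -/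
def IsParityTT (p : Bool) (v : TT) : Prop := ∀ q ∈ v.support, pparity q = p

/-- `v ∈ T ⊗ T` is ℤ-homogeneous of degree `n`, i.e. `v ∈ V_n = Σ_{j+k=n} T_j ⊗ T_k`. -/
def IsDegTT (n : ℤ) (v : TT) : Prop := ∀ q ∈ v.support, q.1.2 + q.2.2 = n

/-- The tensor product map `T × T → T ⊗ T`. -/
def tmul2 (x y : TopN2) : TT :=
  x.sum fun i a => y.sum fun j b => Finsupp.single (i, j) (a * b)

/-- Adjoint diagonal action of the basis vector `e_i` on the basis tensor
`e_{q.1} ⊗ e_{q.2}`:  `[e_i,e_{q.1}] ⊗ e_{q.2} + (−1)^{[i][q.1]} e_{q.1} ⊗ [e_i,e_{q.2}]`. -/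
def actB (i : N2Idx) (q : N2Idx × N2Idx) : TT :=
  tmul2 (bracketAux i q.1) (sing q.2) + ksgn i q.1 • tmul2 (sing q.1) (bracketAux i q.2)

/-- The adjoint diagonal action `x · v` of `T` on `V = T ⊗ T`:
`x·(Σ aᵢ⊗bᵢ) = Σ([x,aᵢ]⊗bᵢ + (−1)^{[x][aᵢ]} aᵢ⊗[x,bᵢ])`. -/
def adT2 (x : TopN2) (v : TT) : TT :=
  x.sum fun i a => v.sum fun q c => (a * c) • actB i q

/-- The super-twist map `τ : T⊗T → T⊗T`, `τ(x₁⊗x₂) = (−1)^{[x₁][x₂]} x₂⊗x₁`. -/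
def twist (v : TT) : TT :=
  v.sum fun q c => (ksgn q.1 q.2 * c) • Finsupp.single (q.2, q.1) (1 : ℂ)

/-- The inner derivation `a_inn : x ↦ (−1)^{[a][x]} x·a` attached to `a ∈ T⊗T`
(extended bilinearly over the homogeneous components of `a` and `x`). -/
def innerDer (a : TT) (x : TopN2) : TT :=
  x.sum fun i c => a.sum fun q e =>
    (c * e * psgn (pparity q && N2parity i)) • actB i q

/-- `d : T → V = T⊗T` is a homogeneous super-derivation of parity `p`:
it is ℂ-linear, maps `T^q` into `V^{q+p}`, and satisfies the super Leibniz rule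
`d([x,y]) = (−1)^{p[x]} x·d(y) − (−1)^{[y](p+[x])} y·d(x)` on homogeneous elements. -/
def IsHomogDer (p : Bool) (d : TopN2 → TT) : Prop :=
  (∀ x y : TopN2, d (x + y) = d x + d y) ∧
  (∀ (c : ℂ) (x : TopN2), d (c • x) = c • d x) ∧
  (∀ (q : Bool) (x : TopN2), IsParityT q x → IsParityTT (xor p q) (d x)) ∧
  (∀ (qx qy : Bool) (x y : TopN2), IsParityT qx x → IsParityT qy y →
    d (brk x y) = psgn (p && qx) • adT2 x (d y) - psgn (qy && (xor p qx)) • adT2 y (d x))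

/-- The tensor cube `T ⊗ T ⊗ T`, modelled as the free ℂ-module on triples of indices. -/
abbrev TTT : Type := (N2Idx × N2Idx × N2Idx) →₀ ℂ

/-- The tensor product map `T × T × T → T ⊗ T ⊗ T`. -/
def tmul3 (x y z : TopN2) : TTT :=
  x.sum fun i a => y.sum fun j b => z.sum fun k c => Finsupp.single (i, j, k) (a * b * c)

/-- Adjoint diagonal action of the basis vector `e_i` on a basis vector of `T⊗T⊗T`. -/
def actB3 (i : N2Idx) (q : N2Idx × N2Idx × N2Idx) : TTT :=
  tmul3 (bracketAux i q.1) (sing q.2.1) (sing q.2.2)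
    + ksgn i q.1 • tmul3 (sing q.1) (bracketAux i q.2.1) (sing q.2.2)
    + (ksgn i q.1 * ksgn i q.2.1) • tmul3 (sing q.1) (sing q.2.1) (bracketAux i q.2.2)

/-- The adjoint diagonal action `x · w` of `T` on `T ⊗ T ⊗ T`. -/
def adT3 (x : TopN2) (w : TTT) : TTT :=
  x.sum fun i a => w.sum fun q c => (a * c) • actB3 i q

/-- The classical Yang–Baxter expression
`c(r) = [r^{12},r^{13}] + [r^{12},r^{23}] + [r^{13},r^{23}] ∈ T⊗T⊗T` for `r ∈ T⊗T`,
written out on homogeneous components with the Koszul signs of the super setting: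
for components `a⊗b` and `a'⊗b'` of `r`, the summand is
`(−1)^{[a'][b]} [a,a']⊗b⊗b' + a⊗[b,a']⊗b' + (−1)^{[a'][b]} a⊗a'⊗[b,b']`. -/
def cybe (r : TT) : TTT :=
  r.sum fun q α => r.sum fun q' β => (α * β) •
    ( ksgn q'.1 q.2 • tmul3 (bracketAux q.1 q'.1) (sing q.2) (sing q'.2)
      + tmul3 (sing q.1) (bracketAux q.2 q'.1) (sing q'.2)
      + ksgn q'.1 q.2 • tmul3 (sing q.1) (sing q'.1) (bracketAux q.2 q'.2) )

/-- Tensoring a basis vector of `T` on the left of an element of `T⊗T`. -/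
def embedL (i : N2Idx) (w : TT) : TTT :=
  w.sum fun q c => Finsupp.single (i, q.1, q.2) c

/-- The super-cyclic map `ξ : T⊗T⊗T → T⊗T⊗T`,
`ξ(x₁⊗x₂⊗x₃) = (−1)^{[x₁]([x₂]+[x₃])} x₂⊗x₃⊗x₁`. -/
def cyc (w : TTT) : TTT :=
  w.sum fun q c =>
    (psgn (N2parity q.1 && (xor (N2parity q.2.1) (N2parity q.2.2))) * c) •
      Finsupp.single (q.2.1, q.2.2, q.1) (1 : ℂ)

/-- `(1 ⊗ Δ) : T⊗T → T⊗T⊗T` for a (linear) map `Δ : T → T⊗T` of parity `p`,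
with the Koszul sign: `(1⊗Δ)(a⊗b) = (−1)^{p[a]} a ⊗ Δ(b)`. -/
def oneTensor (p : Bool) (D : TopN2 → TT) (v : TT) : TTT :=
  v.sum fun q c => (psgn (p && N2parity q.1) * c) • embedL q.1 (D (sing q.2))

/-- `(T,[·,·],D)` is a Lie super-bialgebra with comultiplication `D` of parity `p`:
`D` is ℂ-linear, respects the grading, has image in `Im(1⊗1 − τ)`, satisfies the
super co-Jacobi identity `(1 + ξ + ξ²)∘(1⊗D)∘D = 0`, and the compatibility
(1-cocycle) condition `D[x,y] = (−1)^{p[x]} x·D(y) − (−1)^{[y](p+[x])} y·D(x)`. -/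
def IsLieSuperBialgebra (p : Bool) (D : TopN2 → TT) : Prop :=
  (∀ x y : TopN2, D (x + y) = D x + D y) ∧
  (∀ (c : ℂ) (x : TopN2), D (c • x) = c • D x) ∧
  (∀ (q : Bool) (x : TopN2), IsParityT q x → IsParityTT (xor p q) (D x)) ∧
  (∀ x : TopN2, ∃ s : TT, D x = s - twist s) ∧
  (∀ x : TopN2,
    oneTensor p D (D x) + cyc (oneTensor p D (D x)) + cyc (cyc (oneTensor p D (D x))) = 0) ∧
  (∀ (qx qy : Bool) (x y : TopN2), IsParityT qx x → IsParityT qy y →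
    D (brk x y) = psgn (p && qx) • adT2 x (D y) - psgn (qy && (xor p qx)) • adT2 y (D x))

end

/-- Projection of `v ∈ T⊗T` onto its degree-`n` part `V_n`. -/
noncomputable def projTT (n : ℤ) (v : TT) : TT :=
  v.filter fun q => q.1.2 + q.2.2 = n

/-- The degree-`i` homogeneous component `d_i` of a derivation `d : T → T⊗T`:
for `u ∈ T_j`, `d_i(u)` is the `V_{i+j}`-component of `d(u)`. -/
noncomputable def compDer (d : TopN2 → TT) (i : ℤ) : TopN2 → TT :=
  fun x => x.sum fun idx a => projTT (i + idx.2) (d (Finsupp.single idx a))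

section Bilinearity

lemma brk_add_left (x y z : TopN2) : brk (x + y) z = brk x z + brk y z := by
  unfold brk
  rw [Finsupp.sum_add_index']
  · simp
  · intro i a b
    simp [add_mul, add_smul, Finsupp.sum_add]

lemma brk_add_right (x y z : TopN2) : brk x (y + z) = brk x y + brk x z := by
  unfold brk
  rw [← Finsupp.sum_add]
  refine Finsupp.sum_congr fun i _ => ?_
  rw [Finsupp.sum_add_index']
  · simp
  · intro j a b
    simp [mul_add, add_smul]

@[simp] lemma brk_zero_left (x : TopN2) : brk 0 x = 0 := by simp [brk]

@[simp] lemma brk_zero_right (x : TopN2) : brk x 0 = 0 := by simp [brk]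

lemma brk_single (i j : N2Idx) (a b : ℂ) :
    brk (Finsupp.single i a) (Finsupp.single j b) = (a * b) • bracketAux i j := by
  simp [brk]

lemma adT2_add_left (x y : TopN2) (v : TT) : adT2 (x + y) v = adT2 x v + adT2 y v := by
  unfold adT2
  rw [Finsupp.sum_add_index']
  · simp
  · intro i a b
    simp [add_mul, add_smul, Finsupp.sum_add]

lemma adT2_add_right (x : TopN2) (v w : TT) : adT2 x (v + w) = adT2 x v + adT2 x w := by
  unfold adT2
  rw [← Finsupp.sum_add]
  refine Finsupp.sum_congr fun i _ => ?_
  rw [Finsupp.sum_add_index']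
  · simp
  · intro j a b
    simp [mul_add, add_smul]

@[simp] lemma adT2_zero_left (v : TT) : adT2 0 v = 0 := by simp [adT2]

@[simp] lemma adT2_zero_right (x : TopN2) : adT2 x 0 = 0 := by simp [adT2]

lemma adT2_single (i : N2Idx) (q : N2Idx × N2Idx) (a c : ℂ) :
    adT2 (Finsupp.single i a) (Finsupp.single q c) = (a * c) • actB i q := by
  simp [adT2]

end Bilinearity

section Projection

lemma projTT_add (n : ℤ) (v w : TT) : projTT n (v + w) = projTT n v + projTT n w :=
  Finsupp.filter_add

lemma projTT_smul (n : ℤ) (c : ℂ) (v : TT) : projTT n (c • v) = c • projTT n v :=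
  Finsupp.filter_smul

lemma projTT_sub (n : ℤ) (v w : TT) : projTT n (v - w) = projTT n v - projTT n w :=
  Finsupp.filter_sub _ v w

@[simp] lemma projTT_zero (n : ℤ) : projTT n 0 = 0 := Finsupp.filter_zero _

lemma IsDegTT.projTT {n : ℤ} {v : TT} (hv : IsDegTT n v) (m : ℤ) :
    projTT m v = if m = n then v else 0 := by
  split_ifs with h
  · subst h
    exact (Finsupp.filter_eq_self_iff _ _).2 fun q hq => hv q (Finsupp.mem_support_iff.2 hq)
  · refine (Finsupp.filter_eq_zero_iff _ _).2 fun q hq => ?_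
    by_contra h0
    exact h (hq.symm.trans (hv q (Finsupp.mem_support_iff.2 h0)))

lemma isDegTT_projTT (n : ℤ) (v : TT) : IsDegTT n (projTT n v) := by
  intro q hq
  rw [_root_.projTT, Finsupp.support_filter, Finset.mem_filter] at hq
  exact hq.2

lemma isDegTT_single (q : N2Idx × N2Idx) (c : ℂ) :
    IsDegTT (q.1.2 + q.2.2) (Finsupp.single q c) := by
  intro r hr
  rw [Finset.mem_singleton.1 (Finsupp.support_single_subset hr)]

lemma IsDegTT.add {n : ℤ} {v w : TT} (hv : IsDegTT n v) (hw : IsDegTT n w) :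
    IsDegTT n (v + w) := fun q hq =>
  (Finset.mem_union.1 (Finsupp.support_add hq)).elim (hv q) (hw q)

lemma IsDegTT.smul {n : ℤ} {v : TT} (hv : IsDegTT n v) (c : ℂ) : IsDegTT n (c • v) :=
  fun q hq => hv q (Finsupp.support_smul hq)

lemma isDegTT_zero (n : ℤ) : IsDegTT n 0 := fun q hq => by simp at hq

lemma isDegTT_sum {α : Type*} {n : ℤ} (s : Finset α) (f : α → TT)
    (hf : ∀ a ∈ s, IsDegTT n (f a)) : IsDegTT n (∑ a ∈ s, f a) :=
  Finset.sum_induction f (IsDegTT n) (fun _ _ => IsDegTT.add) (isDegTT_zero n) hf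

lemma IsParityTT.add {p : Bool} {v w : TT} (hv : IsParityTT p v) (hw : IsParityTT p w) :
    IsParityTT p (v + w) := fun q hq =>
  (Finset.mem_union.1 (Finsupp.support_add hq)).elim (hv q) (hw q)

lemma isParityTT_zero (p : Bool) : IsParityTT p 0 := fun q hq => by simp at hq

lemma IsParityTT.projTT {p : Bool} {v : TT} (hv : IsParityTT p v) (n : ℤ) :
    IsParityTT p (projTT n v) := by
  intro q hq
  rw [_root_.projTT, Finsupp.support_filter, Finset.mem_filter] at hq
  exact hv q hq.1

lemma isParityT_single (i : N2Idx) (a : ℂ) : IsParityT (N2parity i) (Finsupp.single i a) := by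
  intro r hr
  rw [Finset.mem_singleton.1 (Finsupp.support_single_subset hr)]

/-- A property of elements of `T` closed under sums holds at `x` as soon as it holds for all
multiples of the basis vectors occurring in `x`. -/
lemma topN2_induction_support {P : TopN2 → Prop} (x : TopN2) (zero : P 0)
    (add : ∀ y z, P y → P z → P (y + z))
    (single : ∀ i ∈ x.support, ∀ a : ℂ, P (Finsupp.single i a)) : P x := by
  rw [← Finsupp.sum_single x]
  exact Finset.sum_induction _ P add zero fun i hi => single i hi _

end Projection

section Grading

lemma isDegT_smul_bT (g : N2Gen) (n : ℤ) (c : ℂ) : IsDegT n (c • bT g n) := by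
  intro i hi
  rw [Finset.mem_singleton.1 (Finsupp.support_single_subset (Finsupp.support_smul hi))]

lemma isDegT_bT (g : N2Gen) (n : ℤ) : IsDegT n (bT g n) := by
  simpa using isDegT_smul_bT g n 1

lemma IsDegT.add {n : ℤ} {x y : TopN2} (hx : IsDegT n x) (hy : IsDegT n y) :
    IsDegT n (x + y) := fun q hq =>
  (Finset.mem_union.1 (Finsupp.support_add hq)).elim (hx q) (hy q)

lemma IsDegT.neg {n : ℤ} {x : TopN2} (hx : IsDegT n x) : IsDegT n (-x) := fun q hq =>
  hx q (by simpa using hq)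

lemma isDegT_zero (n : ℤ) : IsDegT n 0 := fun q hq => by simp at hq

lemma isDegT_bracketAux (i j : N2Idx) : IsDegT (i.2 + j.2) (bracketAux i j) := by
  obtain ⟨g, m⟩ := i
  obtain ⟨h, n⟩ := j
  cases g <;> cases h <;> dsimp only [bracketAux] <;>
    first
    | with_reducible exact isDegT_smul_bT _ _ _
    | with_reducible exact isDegT_bT _ _
    | with_reducible exact (isDegT_bT _ _).neg
    | with_reducible exact (isDegT_smul_bT _ _ _).add (isDegT_smul_bT _ _ _)
    | with_reducible exact isDegT_zero _

lemma IsDegT.tmul2 {m n : ℤ} {x y : TopN2} (hx : IsDegT m x) (hy : IsDegT n y) :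
    IsDegTT (m + n) (tmul2 x y) := by
  refine isDegTT_sum _ _ fun i hi => isDegTT_sum _ _ fun j hj => ?_
  have := isDegTT_single (i, j) (x i * y j)
  rwa [hx i hi, hy j hj] at this

lemma isDegTT_actB (i : N2Idx) (q : N2Idx × N2Idx) :
    IsDegTT (i.2 + (q.1.2 + q.2.2)) (actB i q) := by
  have hl := (isDegT_bracketAux i q.1).tmul2 (isDegT_bT q.2.1 q.2.2)
  have hr := (isDegT_bT q.1.1 q.1.2).tmul2 (isDegT_bracketAux i q.2)
  rw [add_assoc] at hl
  rw [add_left_comm] at hr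
  exact hl.add (hr.smul _)

/-- Acting with a basis vector of degree `i.2` shifts the grading of `T ⊗ T` by `i.2`. -/
lemma projTT_adT2_single (i : N2Idx) (a : ℂ) (n : ℤ) (v : TT) :
    projTT (i.2 + n) (adT2 (Finsupp.single i a) v) =
      adT2 (Finsupp.single i a) (projTT n v) := by
  induction v using Finsupp.induction_linear with
  | zero => simp
  | add v w hv hw => rw [adT2_add_right, projTT_add, projTT_add, adT2_add_right, hv, hw]
  | single q c =>
    rw [adT2_single, projTT_smul, (isDegTT_actB i q).projTT, (isDegTT_single q c).projTT]
    by_cases h : n = q.1.2 + q.2.2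
    · simp [h, adT2_single]
    · simp [h]

end Grading

section Components

lemma compDer_single {d : TopN2 → TT} (h0 : d 0 = 0) (k : ℤ) (i : N2Idx) (a : ℂ) :
    compDer d k (Finsupp.single i a) = projTT (k + i.2) (d (Finsupp.single i a)) := by
  simp [compDer, h0]

@[simp] lemma compDer_zero (d : TopN2 → TT) (k : ℤ) : compDer d k 0 = 0 := by simp [compDer]

lemma compDer_add {d : TopN2 → TT} (h0 : d 0 = 0) (hd : ∀ x y, d (x + y) = d x + d y)
    (k : ℤ) (x y : TopN2) : compDer d k (x + y) = compDer d k x + compDer d k y := by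
  unfold compDer
  exact Finsupp.sum_add_index' (by simp [h0]) (by simp [hd, projTT_add])

lemma compDer_smul {d : TopN2 → TT} (h0 : d 0 = 0) (hd : ∀ (c : ℂ) x, d (c • x) = c • d x)
    (k : ℤ) (c : ℂ) (x : TopN2) : compDer d k (c • x) = c • compDer d k x := by
  unfold compDer
  rw [Finsupp.sum_smul_index (by simp [h0]), Finsupp.smul_sum]
  refine Finsupp.sum_congr fun i _ => ?_
  rw [← projTT_smul, ← hd, Finsupp.smul_single, smul_eq_mul]

lemma IsDegT.compDer_eq {d : TopN2 → TT} (h0 : d 0 = 0) (hd : ∀ x y, d (x + y) = d x + d y)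
    {n : ℤ} {x : TopN2} (hx : IsDegT n x) (k : ℤ) :
    compDer d k x = projTT (k + n) (d x) := by
  refine topN2_induction_support (P := fun x => compDer d k x = projTT (k + n) (d x)) x
    (by simp [h0]) (fun y z hy hz => ?_) fun i hi a => ?_
  · rw [compDer_add h0 hd, hd, projTT_add, hy, hz]
  · rw [compDer_single h0, hx i hi]

namespace IsHomogDer

variable {p : Bool} {d : TopN2 → TT}

lemma map_add (hd : IsHomogDer p d) (x y : TopN2) : d (x + y) = d x + d y := hd.1 x y

lemma map_smul (hd : IsHomogDer p d) (c : ℂ) (x : TopN2) : d (c • x) = c • d x := hd.2.1 c x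

lemma map_zero (hd : IsHomogDer p d) : d 0 = 0 := by
  simpa using hd.map_smul 0 0

lemma compDer_leibniz_single (hd : IsHomogDer p d) (k : ℤ) (i j : N2Idx) (a b : ℂ) :
    compDer d k (brk (Finsupp.single i a) (Finsupp.single j b)) =
      psgn (p && N2parity i) •
        adT2 (Finsupp.single i a) (compDer d k (Finsupp.single j b)) -
      psgn (N2parity j && (xor p (N2parity i))) •
        adT2 (Finsupp.single j b) (compDer d k (Finsupp.single i a)) := by
  have h0 := hd.map_zero
  have hdeg : IsDegT (i.2 + j.2) (brk (Finsupp.single i a) (Finsupp.single j b)) := by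
    rw [brk_single]
    exact fun q hq => isDegT_bracketAux i j q (Finsupp.support_smul hq)
  rw [hdeg.compDer_eq h0 hd.map_add,
    hd.2.2.2 _ _ _ _ (isParityT_single i a) (isParityT_single j b), projTT_sub, projTT_smul,
    projTT_smul, compDer_single h0, compDer_single h0, ← projTT_adT2_single,
    ← projTT_adT2_single, add_left_comm i.2, add_left_comm j.2, add_comm j.2]

/-- The degree-`k` component of a derivation is a derivation of the same parity. -/
lemma isHomogDer_compDer (hd : IsHomogDer p d) (k : ℤ) : IsHomogDer p (compDer d k) := by
  have h0 := hd.map_zero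
  have hadd := compDer_add h0 hd.map_add k
  refine ⟨hadd, compDer_smul h0 hd.map_smul k, fun q x hx => ?_, fun qx qy x y hx hy => ?_⟩
  · refine topN2_induction_support (P := fun x => IsParityTT (xor p q) (compDer d k x)) x
      (by simpa using isParityTT_zero _) (fun y z hy hz => ?_) fun i hi a => ?_
    · rw [hadd]
      exact hy.add hz
    · rw [compDer_single h0, ← hx i hi]
      exact (hd.2.2.1 _ _ (isParityT_single i a)).projTT _
  · refine topN2_induction_support (P := fun x => compDer d k (brk x y) =
      psgn (p && qx) • adT2 x (compDer d k y) -
        psgn (qy && (xor p qx)) • adT2 y (compDer d k x)) x (by simp) ?_ fun i hi a => ?_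
    · intro u v hu hv
      rw [brk_add_left, hadd, hadd, adT2_add_left, adT2_add_right, hu, hv, smul_add, smul_add]
      abel
    · refine topN2_induction_support (P := fun y => compDer d k (brk (Finsupp.single i a) y) =
        psgn (p && qx) • adT2 (Finsupp.single i a) (compDer d k y) -
          psgn (qy && (xor p qx)) • adT2 y (compDer d k (Finsupp.single i a))) y (by simp) ?_
        fun j hj b => ?_
      · intro u v hu hv
        rw [brk_add_right, hadd, hadd, adT2_add_right, adT2_add_left, hu, hv, smul_add,
          smul_add]
        abel
      · rw [← hx i hi, ← hy j hj]
        exact hd.compDer_leibniz_single k i j a b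

lemma isDegTT_compDer (hd : IsHomogDer p d) (k : ℤ) {j : ℤ} {x : TopN2} (hx : IsDegT j x) :
    IsDegTT (k + j) (compDer d k x) := by
  rw [hx.compDer_eq hd.map_zero hd.map_add]
  exact isDegTT_projTT _ _

end IsHomogDer

end Components

section Summability

/-- An element of `T ⊗ T` is the sum of its homogeneous components, indexed with a shift. -/
lemma projTT_finite_and_finsum (c : ℤ) (v : TT) :
    {k : ℤ | projTT (k + c) v ≠ 0}.Finite ∧ v = ∑ᶠ k : ℤ, projTT (k + c) v := by
  induction v using Finsupp.induction_linear with
  | zero => simp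
  | add v w hv hw =>
    simp only [projTT_add]
    exact ⟨(hv.1.union hw.1).subset (Function.support_add _ _),
      by rw [finsum_add_distrib hv.1 hw.1, ← hv.2, ← hw.2]⟩
  | single q a =>
    have h : ∀ k : ℤ, k ≠ q.1.2 + q.2.2 - c →
        projTT (k + c) (Finsupp.single q a : TT) = 0 := fun k hk => by
      rw [(isDegTT_single q a).projTT, if_neg fun h => hk (by omega)]
    refine ⟨(Set.finite_singleton (q.1.2 + q.2.2 - c)).subset fun k hk => ?_, ?_⟩
    · by_contra hne
      exact hk (h k hne)
    · rw [finsum_eq_single _ _ h, (isDegTT_single q a).projTT, if_pos (by omega)]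

lemma IsHomogDer.compDer_finite_and_finsum {p : Bool} {d : TopN2 → TT}
    (hd : IsHomogDer p d) (x : TopN2) :
    {k : ℤ | compDer d k x ≠ 0}.Finite ∧ d x = ∑ᶠ k : ℤ, compDer d k x := by
  have h0 := hd.map_zero
  induction x using Finsupp.induction_linear with
  | zero => simp [h0]
  | add x y hx hy =>
    simp only [compDer_add h0 hd.map_add]
    exact ⟨(hx.1.union hy.1).subset (Function.support_add _ _),
      by rw [finsum_add_distrib hx.1 hy.1, ← hx.2, ← hy.2, hd.map_add]⟩
  | single i a =>
    simp only [compDer_single h0]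
    exact projTT_finite_and_finsum i.2 _

end Summability

section FiniteGeneration

/-- A finite set of generators of the Lie superalgebra `T`. -/
def topN2Generators : Set TopN2 :=
  {bT N2Gen.L 1, bT N2Gen.L (-1), bT N2Gen.L 2, bT N2Gen.L (-2), bT N2Gen.H 1, bT N2Gen.G 0,
    bT N2Gen.Q 1}

namespace IsHomogDer

variable {p : Bool} {d : TopN2 → TT}

lemma map_bracketAux_eq_zero (hd : IsHomogDer p d) {g h : N2Gen} {m n : ℤ}
    (hm : d (bT g m) = 0) (hn : d (bT h n) = 0) : d (bracketAux (g, m) (h, n)) = 0 := by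
  have := hd.2.2.2 _ _ _ _ (isParityT_single (g, m) 1) (isParityT_single (h, n) 1)
  rw [bT] at hm hn
  simpa [brk_single, hm, hn] using this

lemma eq_zero_of_map_smul (hd : IsHomogDer p d) {c : ℂ} (hc : c ≠ 0) {x : TopN2}
    (h : d (c • x) = 0) : d x = 0 := by
  rw [hd.map_smul] at h
  exact (smul_eq_zero.1 h).resolve_left hc

lemma map_L_add (hd : IsHomogDer p d) {m n : ℤ} (hmn : m ≠ n)
    (hm : d (bT N2Gen.L m) = 0) (hn : d (bT N2Gen.L n) = 0) :
    d (bT N2Gen.L (m + n)) = 0 :=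
  hd.eq_zero_of_map_smul (sub_ne_zero.2 (Int.cast_injective.ne hmn))
    (hd.map_bracketAux_eq_zero hm hn)

lemma map_L_eq_zero (hd : IsHomogDer p d) (h : ∀ x ∈ topN2Generators, d x = 0) (n : ℤ) :
    d (bT N2Gen.L n) = 0 := by
  have h1 : d (bT N2Gen.L 1) = 0 := h _ (by simp [topN2Generators])
  have h1' : d (bT N2Gen.L (-1)) = 0 := h _ (by simp [topN2Generators])
  have h2 : d (bT N2Gen.L 2) = 0 := h _ (by simp [topN2Generators])
  have h2' : d (bT N2Gen.L (-2)) = 0 := h _ (by simp [topN2Generators])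
  have pos : ∀ n : ℤ, 2 ≤ n → d (bT N2Gen.L n) = 0 := fun n hn => by
    induction n, hn using Int.leInduction with
    | base => exact h2
    | succ n hn ih => exact hd.map_L_add (by omega) ih h1
  have neg : ∀ n : ℤ, n ≤ -2 → d (bT N2Gen.L n) = 0 := fun n hn => by
    induction n, hn using Int.leInductionDown with
    | base => exact h2'
    | pred n hn ih => exact hd.map_L_add (by omega) ih h1'
  rcases le_or_gt 2 n with hn | hn
  · exact pos n hn
  rcases le_or_gt n (-2) with hn' | hn'
  · exact neg n hn'
  obtain rfl | rfl | rfl : n = -1 ∨ n = 0 ∨ n = 1 := by omega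
  · exact h1'
  · exact hd.map_L_add (m := 1) (n := -1) (by decide) h1 h1'
  · exact h1

/-- A derivation vanishing on the generators vanishes. -/
lemma eq_zero_of_generators (hd : IsHomogDer p d) (h : ∀ x ∈ topN2Generators, d x = 0) :
    d = 0 := by
  have hL := hd.map_L_eq_zero h
  have hH : ∀ n, d (bT N2Gen.H n) = 0 := fun n => by
    have := hd.map_bracketAux_eq_zero (hL (n - 1)) (h (bT N2Gen.H 1) (by simp [topN2Generators]))
    simp only [bracketAux, sub_add_cancel] at this
    exact hd.eq_zero_of_map_smul (by simp) this
  have hQ : ∀ n, d (bT N2Gen.Q n) = 0 := fun n => by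
    have := hd.map_bracketAux_eq_zero (hL (n - 1)) (h (bT N2Gen.Q 1) (by simp [topN2Generators]))
    simp only [bracketAux, sub_add_cancel] at this
    exact hd.eq_zero_of_map_smul (by simp) this
  have hG : ∀ n, d (bT N2Gen.G n) = 0 := fun n => by
    have h0 : d (bT N2Gen.G 0) = 0 := h _ (by simp [topN2Generators])
    rcases eq_or_ne n 0 with rfl | hn
    · exact h0
    have := hd.map_bracketAux_eq_zero (hL n) h0
    simp only [bracketAux, add_zero] at this
    exact hd.eq_zero_of_map_smul (by simpa using hn) this
  have hb : ∀ g n, d (bT g n) = 0 := fun g n => by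
    cases g
    exacts [hL n, hH n, hG n, hQ n]
  funext x
  induction x using Finsupp.induction_linear with
  | zero => exact hd.map_zero
  | add x y hx hy => simp [hd.map_add, hx, hy]
  | single i a =>
    have : (Finsupp.single i a : TopN2) = a • bT i.1 i.2 := by simp [bT]
    rw [this, hd.map_smul, hb, smul_zero, Pi.zero_apply]

lemma finite_compDer_ne_zero (hd : IsHomogDer p d) : {k : ℤ | compDer d k ≠ 0}.Finite := by
  have hfin : topN2Generators.Finite := by
    unfold topN2Generators
    exact Set.toFinite _
  refine (hfin.biUnion fun x _ => (hd.compDer_finite_and_finsum x).1).subset fun k hk => ?_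
  by_contra hne
  simp only [Set.mem_iUnion, Set.mem_ofPred_eq, not_exists, not_not] at hne
  exact hk ((hd.isHomogDer_compDer k).eq_zero_of_generators hne)

end IsHomogDer

end FiniteGeneration

/-- Every (homogeneous-parity) derivation `d ∈ Der(T, T⊗T)`
decomposes as a summable sum `d = Σ_{i∈ℤ} d_i` of homogeneous derivations
`d_i = compDer d i` of degree `i`, and the sum is in fact finite: only
finitely many `d_i` are nonzero. -/
theorem derivation_decomposes_into_finitely_many_homogeneous_components
    (p : Bool) (d : TopN2 → TT) (hd : IsHomogDer p d) :
    (∀ i : ℤ, IsHomogDer p (compDer d i) ∧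
      ∀ (j : ℤ) (x : TopN2), IsDegT j x → IsDegTT (i + j) (compDer d i x)) ∧
    (∀ x : TopN2, {i : ℤ | compDer d i x ≠ 0}.Finite ∧ d x = ∑ᶠ i : ℤ, compDer d i x) ∧
    {i : ℤ | compDer d i ≠ 0}.Finite := by
  refine ⟨fun i => ⟨hd.isHomogDer_compDer i, fun j x hx => hd.isDegTT_compDer i hx⟩,
    hd.compDer_finite_and_finsum, hd.finite_compDer_ne_zero⟩
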